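/- Let L : ℝⁿ × ℝᵐ → ℝ be twice continuously differentiable and ρ-weakly convex–weakly concave, and let η > max(ρ, 0). Then the gradient of the saddle envelope L_η is Lipschitz continuous with constant max{η, η|ρ|/(η−ρ)}; that is, for all z, z̄ ∈ ℝⁿ × ℝᵐ, ‖∇L_η(z) − ∇L_η(z̄)‖ ≤ max{η, η|ρ|/(η−ρ)}·‖z − z̄‖. -/

import Mathlib

open Filter Topology Metric
open scoped RealInnerProductSpace

noncomputable section

abbrev Eu (n : ℕ) : Type := EuclideanSpace ℝ (Fin n)

noncomputable def gradx {n m : ℕ} (L : Eu n × Eu m → ℝ) (z : Eu n × Eu m) : Eu n :=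
  gradient (fun u => L (u, z.2)) z.1

noncomputable def grady {n m : ℕ} (L : Eu n × Eu m → ℝ) (z : Eu n × Eu m) : Eu m :=
  gradient (fun v => L (z.1, v)) z.2

noncomputable def Hxx {n m : ℕ} (L : Eu n × Eu m → ℝ) (z : Eu n × Eu m) : Eu n →L[ℝ] Eu n :=
  fderiv ℝ (fun x => gradient (fun u => L (u, z.2)) x) z.1

noncomputable def Hxy {n m : ℕ} (L : Eu n × Eu m → ℝ) (z : Eu n × Eu m) : Eu m →L[ℝ] Eu n :=
  fderiv ℝ (fun y => gradient (fun u => L (u, y)) z.1) z.2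

noncomputable def Hyx {n m : ℕ} (L : Eu n × Eu m → ℝ) (z : Eu n × Eu m) : Eu n →L[ℝ] Eu m :=
  fderiv ℝ (fun x => gradient (fun v => L (x, v)) z.2) z.1

noncomputable def Hyy {n m : ℕ} (L : Eu n × Eu m → ℝ) (z : Eu n × Eu m) : Eu m →L[ℝ] Eu m :=
  fderiv ℝ (fun y => gradient (fun v => L (z.1, v)) y) z.2

def WeaklyConvexConcave {n m : ℕ} (ρ : ℝ) (L : Eu n × Eu m → ℝ) : Prop :=
  ∀ z : Eu n × Eu m,
    (∀ v : Eu n, -ρ * ‖v‖ ^ 2 ≤ ⟪(Hxx L z) v, v⟫) ∧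
    (∀ w : Eu m, ⟪(Hyy L z) w, w⟫ ≤ ρ * ‖w‖ ^ 2)

def IntDomX {n m : ℕ} (η α : ℝ) (L : Eu n × Eu m → ℝ) : Prop :=
  ∀ z : Eu n × Eu m, ∀ v : Eu n,
    α * ‖v‖ ^ 2 ≤
      ⟪(Hxx L z) v +
        (Hxy L z) ((Ring.inverse (η • (1 : Eu m →L[ℝ] Eu m) - Hyy L z)) ((Hyx L z) v)), v⟫

def IntDomY {n m : ℕ} (η α : ℝ) (L : Eu n × Eu m → ℝ) : Prop :=
  ∀ z : Eu n × Eu m, ∀ w : Eu m,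
    α * ‖w‖ ^ 2 ≤
      ⟪-((Hyy L z) w) +
        (Hyx L z) ((Ring.inverse (η • (1 : Eu n →L[ℝ] Eu n) + Hxx L z)) ((Hxy L z) w)), w⟫

noncomputable def proxObj {n m : ℕ} (η : ℝ) (L : Eu n × Eu m → ℝ) (z w : Eu n × Eu m) : ℝ :=
  L w + η / 2 * ‖w.1 - z.1‖ ^ 2 - η / 2 * ‖w.2 - z.2‖ ^ 2

def IsProxPoint {n m : ℕ} (η : ℝ) (L : Eu n × Eu m → ℝ) (z w : Eu n × Eu m) : Prop :=
  (∀ v : Eu m, proxObj η L z (w.1, v) ≤ proxObj η L z w) ∧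
  (∀ u : Eu n, proxObj η L z w ≤ proxObj η L z (u, w.2))

noncomputable def saddleEnv {n m : ℕ} (η : ℝ) (L : Eu n × Eu m → ℝ)
    (prox : Eu n × Eu m → Eu n × Eu m) (z : Eu n × Eu m) : ℝ :=
  proxObj η L z (prox z)

noncomputable def moreau {n : ℕ} (η : ℝ) (f : Eu n → ℝ) (x : Eu n) : ℝ :=
  ⨅ u : Eu n, (f u + η / 2 * ‖u - x‖ ^ 2)

noncomputable def lyap {n m : ℕ} (η : ℝ) (L : Eu n × Eu m → ℝ) (z : Eu n × Eu m) : ℝ :=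
  -(moreau η (fun v => -L (z.1, v)) z.2) - moreau η (fun u => L (u, z.2)) z.1

noncomputable def hessForm {n m : ℕ} (L : Eu n × Eu m → ℝ) (z v w : Eu n × Eu m) : ℝ :=
  ⟪(Hxx L z) v.1, w.1⟫ + ⟪(Hxy L z) v.2, w.1⟫ + ⟪(Hyx L z) v.1, w.2⟫ + ⟪(Hyy L z) v.2, w.2⟫

section Auxiliary

variable {E : Type*} [NormedAddCommGroup E] [InnerProductSpace ℝ E]

theorem norm_sub_sq_sub_norm_sub_sq (p x x' : E) :
    ‖p - x'‖ ^ 2 - ‖p - x‖ ^ 2 = 2 * ⟪x - p, x' - x⟫ + ‖x' - x‖ ^ 2 := by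
  have h : p - x' = -((x - p) + (x' - x)) := by abel
  rw [h, norm_neg, norm_add_sq_real, norm_sub_rev p x]
  ring

theorem norm_sub_sq_four_point (u u' x x' : E) :
    (‖u' - x‖ ^ 2 - ‖u - x‖ ^ 2) + (‖u - x'‖ ^ 2 - ‖u' - x'‖ ^ 2) =
      2 * ⟪x - x', u - u'⟫ := by
  simp only [← real_inner_self_eq_norm_sq, inner_sub_left, inner_sub_right]
  rw [real_inner_comm x u, real_inner_comm x u', real_inner_comm x' u, real_inner_comm x' u']
  ring

variable [CompleteSpace E]

theorem gradient_fun_neg (f : E → ℝ) : gradient (fun x => -f x) = fun x => -gradient f x := by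
  funext x
  simp [gradient, fderiv_fun_neg]

/-- A minimizer of a weakly convex function plus a quadratic satisfies quadratic growth. -/
theorem quadratic_growth_of_forall_le {f : E → ℝ} (hf : ContDiff ℝ 2 f) {ρ η : ℝ} {x u : E}
    (hH : ∀ z v : E, -ρ * ‖v‖ ^ 2 ≤ ⟪fderiv ℝ (gradient f) z v, v⟫)
    (hmin : ∀ w, f u + η / 2 * ‖u - x‖ ^ 2 ≤ f w + η / 2 * ‖w - x‖ ^ 2) (w : E) :
    f u + η / 2 * ‖u - x‖ ^ 2 + (η - ρ) / 2 * ‖w - u‖ ^ 2 ≤ f w + η / 2 * ‖w - x‖ ^ 2 := by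
  obtain ⟨e, rfl⟩ : ∃ e, w = u + e := ⟨w - u, by abel⟩
  have hline (t : ℝ) : HasDerivAt (fun t : ℝ => u + t • e) e t := by
    simpa using ((hasDerivAt_id t).smul_const e).const_add u
  have hgrad : Differentiable ℝ (gradient f) := by
    have h1 : ContDiff ℝ 1 (fderiv ℝ f) := hf.fderiv_right (by norm_num)
    exact (InnerProductSpace.toDual ℝ E).symm.differentiable.comp (h1.differentiable (by norm_num))
  have hsq (t : ℝ) : ‖u + t • e - x‖ ^ 2 =
      ‖u - x‖ ^ 2 + 2 * t * ⟪e, u - x⟫ + t ^ 2 * ‖e‖ ^ 2 := by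
    rw [show u + t • e - x = (u - x) + t • e by abel, norm_add_sq_real, norm_smul,
      real_inner_smul_right, real_inner_comm, mul_pow, Real.norm_eq_abs, sq_abs]
    ring
  set ψ : ℝ → ℝ := fun t => f (u + t • e) + η * ⟪e, u - x⟫ * t + ρ / 2 * ‖e‖ ^ 2 * t ^ 2 with hψ
  set ψ' : ℝ → ℝ := fun t => ⟪gradient f (u + t • e), e⟫ + η * ⟪e, u - x⟫ + ρ * ‖e‖ ^ 2 * t
    with hψ'
  have hd (t : ℝ) : HasDerivAt ψ (ψ' t) t := by
    have hg := ((hf.differentiable (by norm_num)) (u + t • e)).hasGradientAt.hasFDerivAt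
    have h1 := hg.comp_hasDerivAt t (hline t)
    have h2 := (hasDerivAt_id t).const_mul (η * ⟪e, u - x⟫)
    have h3 := (hasDerivAt_pow 2 t).const_mul (ρ / 2 * ‖e‖ ^ 2)
    refine ((h1.add h2).add h3).congr_deriv ?_
    simp only [hψ', InnerProductSpace.toDual_apply_apply]
    push_cast
    ring
  have hd' (t : ℝ) : HasDerivAt ψ' (⟪fderiv ℝ (gradient f) (u + t • e) e, e⟫ + ρ * ‖e‖ ^ 2) t := by
    have h1 := (hgrad (u + t • e)).hasFDerivAt.comp_hasDerivAt t (hline t)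
    have h2 := h1.inner ℝ (hasDerivAt_const t e)
    have h3 := (hasDerivAt_id t).const_mul (ρ * ‖e‖ ^ 2)
    refine ((h2.add_const (η * ⟪e, u - x⟫)).add h3).congr_deriv ?_
    rw [inner_zero_right]
    ring
  have hmono : Monotone ψ' := by
    refine monotone_of_deriv_nonneg (fun t => (hd' t).differentiableAt) fun t => ?_
    rw [(hd' t).deriv]
    linarith [hH (u + t • e) e]
  have hzero : ψ' 0 = 0 := by
    have hloc : IsLocalMin (fun t => ψ t + (η - ρ) / 2 * ‖e‖ ^ 2 * t ^ 2) 0 := by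
      refine Eventually.of_forall fun t => ?_
      have := hmin (u + t • e)
      rw [hsq] at this
      simp only [hψ, zero_smul, add_zero]
      linarith
    have h3 := (hd 0).add ((hasDerivAt_pow 2 (0 : ℝ)).const_mul ((η - ρ) / 2 * ‖e‖ ^ 2))
    simpa using hloc.hasDerivAt_eq_zero h3
  have hψmono : MonotoneOn ψ (Set.Ici 0) := by
    refine monotoneOn_of_deriv_nonneg (convex_Ici 0)
      (fun t _ => (hd t).continuousAt.continuousWithinAt)
      (fun t _ => (hd t).differentiableAt.differentiableWithinAt) fun t ht => ?_
    rw [interior_Ici] at ht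
    rw [(hd t).deriv, ← hzero]
    exact hmono (le_of_lt ht)
  have h01 := hψmono (Set.mem_Ici.2 le_rfl) (Set.mem_Ici.2 zero_le_one) zero_le_one
  have h1 := hsq 1
  simp only [hψ, one_smul, zero_smul, add_zero] at h01 h1
  rw [h1, add_sub_cancel_left]
  linarith

/-- Gradient formula for an envelope function sandwiched between two quadratic differences. -/
theorem hasGradientAt_of_envelope_bounds {F : E → ℝ} {p : E → E} {η K : ℝ} {x : E}
    (hη : 0 ≤ η) (hp : ∀ x', ‖p x' - p x‖ ≤ K * ‖x' - x‖)
    (hub : ∀ x', F x' - F x ≤ η / 2 * (‖p x - x'‖ ^ 2 - ‖p x - x‖ ^ 2))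
    (hlb : ∀ x', η / 2 * (‖p x' - x'‖ ^ 2 - ‖p x' - x‖ ^ 2) ≤ F x' - F x) :
    HasGradientAt F (η • (x - p x)) x := by
  rw [hasGradientAt_iff_isLittleO]
  have hbig : (fun x' => F x' - F x - ⟪η • (x - p x), x' - x⟫) =O[𝓝 x]
      fun x' => ‖x' - x‖ ^ 2 := by
    refine Asymptotics.IsBigO.of_bound (η / 2 + η * |K|) (Eventually.of_forall fun x' => ?_)
    have hu := hub x'
    have hl := hlb x'
    rw [norm_sub_sq_sub_norm_sub_sq] at hu hl
    have hsplit : ⟪x - p x', x' - x⟫ = ⟪x - p x, x' - x⟫ - ⟪p x' - p x, x' - x⟫ := by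
      rw [← inner_sub_left]
      congr 1
      abel
    have hcs : ⟪p x' - p x, x' - x⟫ ≤ |K| * ‖x' - x‖ ^ 2 := by
      refine (real_inner_le_norm _ _).trans ?_
      have := (hp x').trans (mul_le_mul_of_nonneg_right (le_abs_self K) (norm_nonneg _))
      nlinarith [mul_le_mul_of_nonneg_right this (norm_nonneg (x' - x))]
    have hcs' := mul_le_mul_of_nonneg_left hcs hη
    have hpos : 0 ≤ η * (|K| * ‖x' - x‖ ^ 2) := by positivity
    have hpos' : 0 ≤ η * ‖x' - x‖ ^ 2 := by positivity
    rw [real_inner_smul_left, Real.norm_eq_abs, Real.norm_eq_abs, abs_of_nonneg (sq_nonneg ‖x' - x‖),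
      abs_le]
    rw [hsplit] at hl
    constructor <;> nlinarith
  exact hbig.trans_isLittleO (Asymptotics.isLittleO_pow_sub_sub x one_lt_two)

end Auxiliary

/-- If `F + ρ I` is monotone, `g` is an increment of `F` over `d`, and `s = d + g / η`, then `g`
is controlled by `s`; the hypothesis and conclusion are expressed with `g = η • (s - d)`. -/
theorem norm_sub_le_of_inner_ge {E : Type*} [NormedAddCommGroup E] [InnerProductSpace ℝ E]
    {ρ η : ℝ} (hη : max ρ 0 < η) {s d : E} (h : (η - ρ) * ‖d‖ ^ 2 ≤ η * ⟪s, d⟫) :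
    η * ‖s - d‖ ≤ max η (η * |ρ| / (η - ρ)) * ‖s‖ := by
  obtain ⟨hρη, hη0⟩ := max_lt_iff.1 hη
  have hpos : 0 < η - ρ := sub_pos.2 hρη
  obtain ⟨g, rfl⟩ : ∃ g, d = s - g := ⟨s - d, by abel⟩
  rw [sub_sub_cancel]
  rw [norm_sub_sq_real, inner_sub_right, real_inner_self_eq_norm_sq] at h
  have hcs := abs_le.1 (abs_real_inner_le_norm s g)
  have hs := norm_nonneg s
  have hg := norm_nonneg g
  have key : (η - ρ) * ‖g‖ ^ 2 ≤ ρ * ‖s‖ ^ 2 + (η - 2 * ρ) * ⟪s, g⟫ := by linarith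
  rcases le_total (2 * ρ) η with h2 | h2
  · have hgs : ‖g‖ ≤ ‖s‖ := by
      have hfac : (‖g‖ - ‖s‖) * ((η - ρ) * ‖g‖ + ρ * ‖s‖) ≤ 0 := by
        nlinarith [mul_le_mul_of_nonneg_left hcs.2 (sub_nonneg.2 h2)]
      by_contra! hlt
      have : 0 < (η - ρ) * ‖g‖ + ρ * ‖s‖ := by nlinarith
      nlinarith [mul_pos (sub_pos.2 hlt) this]
    exact mul_le_mul (le_max_left _ _) hgs hg (hη0.le.trans (le_max_left _ _))
  · have hρ : 0 < ρ := by linarith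
    have hgs : (η - ρ) * ‖g‖ ≤ ρ * ‖s‖ := by
      have hfac : (‖g‖ + ‖s‖) * ((η - ρ) * ‖g‖ - ρ * ‖s‖) ≤ 0 := by
        nlinarith [mul_le_mul_of_nonneg_left hcs.1 (sub_nonneg.2 h2)]
      by_contra! hlt
      have hg0 : 0 < ‖g‖ := by
        by_contra! h0
        nlinarith
      nlinarith [mul_pos (add_pos_of_pos_of_nonneg hg0 hs) (sub_pos.2 hlt)]
    refine le_trans ?_ (mul_le_mul_of_nonneg_right (le_max_right _ _) hs)
    rw [abs_of_pos hρ, div_mul_eq_mul_div, le_div_iff₀ hpos]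
    nlinarith [mul_le_mul_of_nonneg_left hgs hη0.le]

section SaddleEnvelope

variable {n m : ℕ} {L : Eu n × Eu m → ℝ} {ρ η : ℝ}

theorem IsProxPoint.growth_fst (hL : ContDiff ℝ 2 L) (hweak : WeaklyConvexConcave ρ L)
    {z w : Eu n × Eu m} (hw : IsProxPoint η L z w) (u : Eu n) :
    proxObj η L z w + (η - ρ) / 2 * ‖u - w.1‖ ^ 2 ≤ proxObj η L z (u, w.2) := by
  have hf : ContDiff ℝ 2 fun u => L (u, w.2) := hL.comp (contDiff_prodMk_left w.2)
  have := quadratic_growth_of_forall_le hf (ρ := ρ) (η := η) (x := z.1) (u := w.1)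
    (fun a v => (hweak (a, w.2)).1 v)
    (fun a => by
      have := hw.2 a
      simp only [proxObj] at this
      linarith) u
  simp only [proxObj]
  linarith

theorem IsProxPoint.growth_snd (hL : ContDiff ℝ 2 L) (hweak : WeaklyConvexConcave ρ L)
    {z w : Eu n × Eu m} (hw : IsProxPoint η L z w) (v : Eu m) :
    proxObj η L z (w.1, v) + (η - ρ) / 2 * ‖v - w.2‖ ^ 2 ≤ proxObj η L z w := by
  have hf : ContDiff ℝ 2 fun v => -L (w.1, v) := (hL.comp (contDiff_prodMk_right w.1)).neg
  have := quadratic_growth_of_forall_le hf (ρ := ρ) (η := η) (x := z.2) (u := w.2)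
    (fun a v => by
      have := (hweak (w.1, a)).2 v
      rw [gradient_fun_neg, fderiv_fun_neg, neg_apply, inner_neg_left]
      simp only [Hyy] at this
      linarith)
    (fun a => by
      have := hw.1 a
      simp only [proxObj] at this
      linarith) v
  simp only [proxObj]
  linarith

theorem IsProxPoint.inner_ge (hL : ContDiff ℝ 2 L) (hweak : WeaklyConvexConcave ρ L)
    {z zb w wb : Eu n × Eu m} (hw : IsProxPoint η L z w) (hwb : IsProxPoint η L zb wb) :
    (η - ρ) * (‖w.1 - wb.1‖ ^ 2 + ‖w.2 - wb.2‖ ^ 2) ≤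
      η * (⟪z.1 - zb.1, w.1 - wb.1⟫ + ⟪z.2 - zb.2, w.2 - wb.2⟫) := by
  have h1 := hw.growth_fst hL hweak wb.1
  have h2 := hw.growth_snd hL hweak wb.2
  have h3 := hwb.growth_fst hL hweak w.1
  have h4 := hwb.growth_snd hL hweak w.2
  have e1 := norm_sub_sq_four_point w.1 wb.1 z.1 zb.1
  have e2 := norm_sub_sq_four_point w.2 wb.2 z.2 zb.2
  rw [norm_sub_rev] at h1 h2
  simp only [proxObj] at h1 h2 h3 h4
  linear_combination h1 + h2 + h3 + h4 + η / 2 * e1 + η / 2 * e2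

theorem inner_toLp_prod (a b : Eu n × Eu m) :
    ⟪WithLp.toLp 2 a, WithLp.toLp 2 b⟫ = ⟪a.1, b.1⟫ + ⟪a.2, b.2⟫ :=
  WithLp.prod_inner_apply _ _

theorem norm_sq_toLp_prod (a : Eu n × Eu m) :
    ‖WithLp.toLp 2 a‖ ^ 2 = ‖a.1‖ ^ 2 + ‖a.2‖ ^ 2 :=
  WithLp.prod_norm_sq_eq_of_L2 _

theorem IsProxPoint.norm_sub_le (hL : ContDiff ℝ 2 L) (hweak : WeaklyConvexConcave ρ L)
    (hη : max ρ 0 < η)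
    {z zb w wb : Eu n × Eu m} (hw : IsProxPoint η L z w) (hwb : IsProxPoint η L zb wb) :
    ‖WithLp.toLp 2 (w - wb)‖ ≤ η / (η - ρ) * ‖WithLp.toLp 2 (z - zb)‖ := by
  have hpos : 0 < η - ρ := sub_pos.2 (max_lt_iff.1 hη).1
  have h := hw.inner_ge hL hweak hwb
  have hcs := real_inner_le_norm (WithLp.toLp 2 (z - zb)) (WithLp.toLp 2 (w - wb))
  rw [inner_toLp_prod] at hcs
  have hn := norm_sq_toLp_prod (w - wb)
  simp only [Prod.fst_sub, Prod.snd_sub] at hcs hn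
  rw [← hn] at h
  rw [div_mul_eq_mul_div, le_div_iff₀ hpos]
  by_contra! hlt
  have h0 : 0 < ‖WithLp.toLp 2 (w - wb)‖ := by
    by_contra! h0
    have : ‖WithLp.toLp 2 (w - wb)‖ = 0 := le_antisymm h0 (norm_nonneg _)
    rw [this, zero_mul] at hlt
    exact absurd hlt (not_lt.2 (mul_nonneg (max_lt_iff.1 hη).2.le (norm_nonneg _)))
  nlinarith [mul_lt_mul_of_pos_right hlt h0,
    mul_le_mul_of_nonneg_left hcs (max_lt_iff.1 hη).2.le]

variable {prox : Eu n × Eu m → Eu n × Eu m}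

theorem gradx_saddleEnv (hL : ContDiff ℝ 2 L) (hweak : WeaklyConvexConcave ρ L)
    (hη : max ρ 0 < η) (hprox : ∀ z, IsProxPoint η L z (prox z)) (z : Eu n × Eu m) :
    gradx (saddleEnv η L prox) z = η • (z.1 - (prox z).1) := by
  refine (hasGradientAt_of_envelope_bounds (p := fun x => (prox (x, z.2)).1)
    (K := η / (η - ρ)) (max_lt_iff.1 hη).2.le (fun x' => ?_) (fun x' => ?_)
    (fun x' => ?_)).gradient
  · have h := (hprox (x', z.2)).norm_sub_le hL hweak hη (hprox z)
    have h1 : ‖WithLp.toLp 2 ((x', z.2) - z)‖ = ‖x' - z.1‖ := by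
      rw [← sq_eq_sq₀ (norm_nonneg _) (norm_nonneg _), norm_sq_toLp_prod]
      simp
    rw [h1] at h
    refine le_trans ?_ h
    rw [← sq_le_sq₀ (norm_nonneg _) (norm_nonneg _), norm_sq_toLp_prod]
    simp
  · have h1 := (hprox (x', z.2)).2 (prox z).1
    have h2 := (hprox z).1 (prox (x', z.2)).2
    simp only [saddleEnv, proxObj] at *
    linarith
  · have h1 := (hprox (x', z.2)).1 (prox z).2
    have h2 := (hprox z).2 (prox (x', z.2)).1
    simp only [saddleEnv, proxObj] at *
    linarith

theorem grady_saddleEnv (hL : ContDiff ℝ 2 L) (hweak : WeaklyConvexConcave ρ L)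
    (hη : max ρ 0 < η) (hprox : ∀ z, IsProxPoint η L z (prox z)) (z : Eu n × Eu m) :
    grady (saddleEnv η L prox) z = -(η • (z.2 - (prox z).2)) := by
  rw [eq_neg_iff_add_eq_zero, ← neg_eq_iff_add_eq_zero]
  have hneg := congrFun (gradient_fun_neg fun v => saddleEnv η L prox (z.1, v)) z.2
  rw [grady, ← hneg]
  refine (hasGradientAt_of_envelope_bounds (p := fun y => (prox (z.1, y)).2)
    (K := η / (η - ρ)) (max_lt_iff.1 hη).2.le (fun y' => ?_) (fun y' => ?_)
    (fun y' => ?_)).gradient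
  · have h := (hprox (z.1, y')).norm_sub_le hL hweak hη (hprox z)
    have h1 : ‖WithLp.toLp 2 ((z.1, y') - z)‖ = ‖y' - z.2‖ := by
      rw [← sq_eq_sq₀ (norm_nonneg _) (norm_nonneg _), norm_sq_toLp_prod]
      simp
    rw [h1] at h
    refine le_trans ?_ h
    rw [← sq_le_sq₀ (norm_nonneg _) (norm_nonneg _), norm_sq_toLp_prod]
    simp
  · have h1 := (hprox (z.1, y')).1 (prox z).2
    have h2 := (hprox z).2 (prox (z.1, y')).1
    simp only [saddleEnv, proxObj] at *
    linarith
  · have h1 := (hprox (z.1, y')).2 (prox z).1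
    have h2 := (hprox z).1 (prox (z.1, y')).2
    simp only [saddleEnv, proxObj] at *
    linarith

end SaddleEnvelope

/-- the saddle envelope has a Lipschitz gradient with constant
max{η, η|ρ|/(η−ρ)}. -/
theorem statement8 {n m : ℕ}
    (L : Eu n × Eu m → ℝ) (ρ η : ℝ)
    (hL : ContDiff ℝ 2 L)
    (hweak : WeaklyConvexConcave ρ L)
    (hη : max ρ 0 < η)
    (prox : Eu n × Eu m → Eu n × Eu m)
    (hprox : ∀ z, IsProxPoint η L z (prox z))
    (hprox_uniq : ∀ z w, IsProxPoint η L z w → w = prox z) :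
    ∀ z zb : Eu n × Eu m,
      Real.sqrt (‖gradx (saddleEnv η L prox) z - gradx (saddleEnv η L prox) zb‖ ^ 2 +
          ‖grady (saddleEnv η L prox) z - grady (saddleEnv η L prox) zb‖ ^ 2) ≤
        max η (η * |ρ| / (η - ρ)) *
          Real.sqrt (‖z.1 - zb.1‖ ^ 2 + ‖z.2 - zb.2‖ ^ 2) := by
  intro z zb
  have hη0 : 0 ≤ η := (max_lt_iff.1 hη).2.le
  have h := (hprox z).inner_ge hL hweak (hprox zb)
  have key := norm_sub_le_of_inner_ge hη (s := WithLp.toLp 2 (z - zb))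
    (d := WithLp.toLp 2 (prox z - prox zb)) (by
      rw [norm_sq_toLp_prod, inner_toLp_prod]
      exact h)
  have hs : ‖WithLp.toLp 2 (z - zb)‖ = Real.sqrt (‖z.1 - zb.1‖ ^ 2 + ‖z.2 - zb.2‖ ^ 2) := by
    rw [← Real.sqrt_sq (norm_nonneg _), norm_sq_toLp_prod]
    rfl
  rw [← hs]
  refine le_trans (Real.sqrt_le_iff.2 ⟨by positivity, le_of_eq ?_⟩) key
  simp only [gradx_saddleEnv hL hweak hη hprox, grady_saddleEnv hL hweak hη hprox]
  have e1 : η • (z.1 - (prox z).1) - η • (zb.1 - (prox zb).1) =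
      η • (z - zb - (prox z - prox zb)).1 := by
    simp only [Prod.fst_sub, ← smul_sub, sub_sub_sub_comm]
  have e2 : -(η • (z.2 - (prox z).2)) - -(η • (zb.2 - (prox zb).2)) =
      -(η • (z - zb - (prox z - prox zb)).2) := by
    rw [neg_sub_neg, ← neg_sub, ← smul_sub, sub_sub_sub_comm]
    rfl
  rw [e1, e2, norm_neg, ← WithLp.toLp_sub, mul_pow, norm_sq_toLp_prod, norm_smul, norm_smul,
    mul_pow, mul_pow, Real.norm_eq_abs, sq_abs, ← mul_add]

end
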